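/- For every real number φ with 0 ≤ φ < π²/2 there exists a C² function 𝐟 : D → ℝ on the open unit disk D = {(u,v) : u² + v² < 1} satisfying the minimal surface equation on D, such that the origin is a symmetric point of 𝐟 (i.e. ∇_h𝐟(0,0) = 0 and ∇²_{h,ih}𝐟(0,0) = 0 for some unit vector h), and the Gaussian curvature K of the graph of 𝐟 at the point above the origin satisfies |K| = φ. -/

import Mathlib

open Real Set

/-- Partial derivative in the `u` (first coordinate) direction. -/
noncomputable def pdu (f : ℝ × ℝ → ℝ) (p : ℝ × ℝ) : ℝ := lineDeriv ℝ f p (1, 0)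

/-- Partial derivative in the `v` (second coordinate) direction. -/
noncomputable def pdv (f : ℝ × ℝ → ℝ) (p : ℝ × ℝ) : ℝ := lineDeriv ℝ f p (0, 1)

/-- The open unit disk in `ℝ²`. -/
def unitDisk : Set (ℝ × ℝ) := {p | p.1 ^ 2 + p.2 ^ 2 < 1}

/-- The Gaussian curvature of the graph of `f` at the point above `p`. -/
noncomputable def gaussCurv (f : ℝ × ℝ → ℝ) (p : ℝ × ℝ) : ℝ :=
  (pdu (pdu f) p * pdv (pdv f) p - (pdv (pdu f) p) ^ 2) /
    (1 + (pdu f p) ^ 2 + (pdv f p) ^ 2) ^ 2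

/-- `f` satisfies the minimal surface equation on `D`. -/
def MinimalSurfaceEq (f : ℝ × ℝ → ℝ) (D : Set (ℝ × ℝ)) : Prop :=
  ∀ p ∈ D, (1 + (pdv f p) ^ 2) * pdu (pdu f) p
      - 2 * pdu f p * pdv f p * pdv (pdu f) p
      + (1 + (pdu f p) ^ 2) * pdv (pdv f) p = 0

/-- `ζ` is an `h`-symmetric point of `f`: `h` is a unit vector,
`∇ₕ f(ζ) = 0` and `∇²_{h, ih} f(ζ) = 0` where `ih = (-h₂, h₁)`. -/
def IsSymmetricPt (f : ℝ × ℝ → ℝ) (ζ : ℝ × ℝ) (h : ℝ × ℝ) : Prop :=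
  h.1 ^ 2 + h.2 ^ 2 = 1 ∧ lineDeriv ℝ f ζ h = 0 ∧
    lineDeriv ℝ (fun p => lineDeriv ℝ f p h) ζ (-h.2, h.1) = 0

/-- An autonomous ODE `ψ' = P ψ` on the line with a continuous positive bounded right-hand side
has a global solution, namely the inverse of a primitive of `1 / P`. -/
lemma exists_global_solution_of_pos_bounded {P : ℝ → ℝ} {M : ℝ} (hP : Continuous P)
    (hpos : ∀ x, 0 < P x) (hM : ∀ x, P x ≤ M) (a : ℝ) :
    ∃ ψ : ℝ → ℝ, ψ 0 = a ∧ ∀ x, HasDerivAt ψ (P (ψ x)) x := by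
  have hM0 : 0 < M := (hpos 0).trans_le (hM 0)
  have hcont : Continuous fun s => (P s)⁻¹ := hP.inv₀ fun x => (hpos x).ne'
  set T : ℝ → ℝ := fun x => ∫ s in a..x, (P s)⁻¹ with hT
  have hTd : ∀ x, HasDerivAt T (P x)⁻¹ x := fun x =>
    intervalIntegral.integral_hasDerivAt_right (hcont.intervalIntegrable _ _)
      (hcont.stronglyMeasurableAtFilter _ _) hcont.continuousAt
  have hTmono : StrictMono T := strictMono_of_hasDerivAt_pos hTd fun x => inv_pos.2 (hpos x)
  have hTcont : Continuous T := continuous_iff_continuousAt.2 fun x => (hTd x).continuousAt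
  have hgrow : Monotone fun x => T x - M⁻¹ * x := by
    refine monotone_of_hasDerivAt_nonneg (f' := fun x => (P x)⁻¹ - M⁻¹) (fun x => ?_) fun x => ?_
    · simpa using (hTd x).fun_sub ((hasDerivAt_id x).const_mul M⁻¹)
    · exact sub_nonneg.2 (inv_anti₀ (hpos x) (hM x))
  have hTa : T a = 0 := by simp [hT]
  have hsurj : Function.Surjective T := by
    refine hTcont.surjective ?_ ?_
    · refine Filter.tendsto_atTop_mono' _ ?_
        ((Filter.tendsto_id.atTop_add (tendsto_const_nhds (x := -a))).const_mul_atTop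
          (inv_pos.2 hM0))
      filter_upwards [Filter.eventually_ge_atTop a] with x hx
      have := hgrow hx
      simp only [hTa] at this
      simp only [id]
      linarith
    · refine Filter.tendsto_atBot_mono' _ ?_
        ((Filter.tendsto_id.atBot_add (tendsto_const_nhds (x := -a))).const_mul_atBot
          (inv_pos.2 hM0))
      filter_upwards [Filter.eventually_le_atBot a] with x hx
      have := hgrow hx
      simp only [hTa] at this
      simp only [id]
      linarith
  let e : ℝ ≃o ℝ := hTmono.orderIsoOfSurjective T hsurj
  have he : ∀ x, T (e.symm x) = x := fun x => e.apply_symm_apply x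
  refine ⟨e.symm, ?_, fun x => ?_⟩
  · rw [← hTa]
    exact e.symm_apply_apply a
  · have := HasDerivAt.of_local_left_inverse (f := T) (g := e.symm) (a := x)
      e.symm.continuous.continuousAt (hTd _) (inv_pos.2 (hpos _)).ne'
      (Filter.Eventually.of_forall he)
    simpa using this

/-- The elliptic function `s` with `s'² = l² (1 - s²) (1 + b + b s²)` and `s 0 = 1`, together with
`c = s' / l`, and positivity of `s` on an explicit interval around the origin. -/
lemma exists_elliptic_sine {b l : ℝ} (hb : 0 < b) (hl : 0 < l) :
    ∃ s c : ℝ → ℝ, (∀ x, HasDerivAt s (l * c x) x) ∧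
      (∀ x, HasDerivAt c (l * (-s x - 2 * b * s x ^ 3)) x) ∧
      (∀ x, c x ^ 2 = 1 + b - s x ^ 2 - b * s x ^ 4) ∧ s 0 = 1 ∧ c 0 = 0 ∧
      ∀ x, l ^ 2 * (1 + 2 * b) * x ^ 2 < (π / 2) ^ 2 → 0 < s x := by
  have hbase : ∀ x, 0 < 1 + b + b * sin x ^ 2 := fun x => by positivity
  set R : ℝ → ℝ := fun x => √(1 + b + b * sin x ^ 2) with hR
  have hRpos : ∀ x, 0 < R x := fun x => Real.sqrt_pos.2 (hbase x)
  have hRsq : ∀ x, R x ^ 2 = 1 + b + b * sin x ^ 2 := fun x => Real.sq_sqrt (hbase x).le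
  have hRle : ∀ x, R x ≤ √(1 + 2 * b) := fun x => Real.sqrt_le_sqrt (by
    nlinarith [Real.sin_sq_le_one x])
  have hRd : ∀ x, HasDerivAt R (b * sin x * cos x / R x) x := fun x => by
    have h := ((((Real.hasDerivAt_sin x).fun_pow 2).const_mul b).const_add (1 + b)).sqrt
      (hbase x).ne'
    refine h.congr_deriv ?_
    have := (hRpos x).ne'
    simp only [hR] at this ⊢
    field_simp
    norm_num
    ring
  obtain ⟨ψ, hψ0, hψ⟩ := exists_global_solution_of_pos_bounded (P := fun x => l * R x)
    (M := l * √(1 + 2 * b)) (by fun_prop) (fun x => mul_pos hl (hRpos x))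
    (fun x => mul_le_mul_of_nonneg_left (hRle x) hl.le) (π / 2)
  refine ⟨fun x => sin (ψ x), fun x => cos (ψ x) * R (ψ x), fun x => ?_, fun x => ?_, fun x => ?_,
    by simp [hψ0], by simp [hψ0], fun x hx => ?_⟩
  · convert (hψ x).sin using 1
    ring
  · refine ((hψ x).cos.fun_mul ((hRd (ψ x)).comp x (hψ x))).congr_deriv ?_
    have := (hRpos (ψ x)).ne'
    rw [Function.comp_apply]
    field_simp
    have h1 := hRsq (ψ x)
    have h2 := Real.sin_sq_add_cos_sq (ψ x)
    linear_combination b * sin (ψ x) * h2 - sin (ψ x) * h1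
  · rw [mul_pow, hRsq, Real.cos_sq']
    ring
  · have hlip : |ψ x - π / 2| ≤ l * √(1 + 2 * b) * |x| := by
      have := Convex.norm_image_sub_le_of_norm_hasDerivWithin_le (f := ψ)
        (f' := fun x => l * R (ψ x)) (C := l * √(1 + 2 * b)) (s := Set.univ) (x := 0) (y := x)
        (fun x _ => (hψ x).hasDerivWithinAt) (fun x _ => by
          rw [Real.norm_of_nonneg (mul_pos hl (hRpos _)).le]
          exact mul_le_mul_of_nonneg_left (hRle _) hl.le) convex_univ trivial trivial
      simpa [hψ0] using this
    have hlt : l * √(1 + 2 * b) * |x| < π / 2 := by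
      refine lt_of_pow_lt_pow_left₀ 2 (by positivity) ?_
      rw [mul_pow, mul_pow, Real.sq_sqrt (by positivity), sq_abs]
      exact hx
    have := abs_lt.1 (hlip.trans_lt hlt)
    exact Real.sin_pos_of_pos_of_lt_pi (by linarith) (by linarith)

/-- The quartic form under the square root in the gradient of the surface. -/
def quarticForm (b s t : ℝ) : ℝ := b * (1 + b) * (s ^ 2 + t ^ 2) ^ 2 + s ^ 2 * t ^ 2

lemma quarticForm_pos {b s t : ℝ} (hb : 0 < b) (h : 0 < s ∨ 0 < t) : 0 < quarticForm b s t := by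
  unfold quarticForm
  rcases h with h | h <;> positivity

lemma quarticForm_comm (b s t : ℝ) : quarticForm b s t = quarticForm b t s := by
  unfold quarticForm
  ring

/-- A primitive of `1 / √(b (1 + b) + cos² (2 α) / 4)`. -/
noncomputable def angleHeight (b a : ℝ) : ℝ :=
  ∫ x in (0 : ℝ)..a, (√(b * (1 + b) + cos (2 * x) ^ 2 / 4))⁻¹

lemma hasDerivAt_angleHeight {b : ℝ} (hb : 0 < b) (a : ℝ) :
    HasDerivAt (angleHeight b) (√(b * (1 + b) + cos (2 * a) ^ 2 / 4))⁻¹ a := by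
  have hcont : Continuous fun x : ℝ => (√(b * (1 + b) + cos (2 * x) ^ 2 / 4))⁻¹ := by
    refine Continuous.inv₀ (by fun_prop) fun x => ?_
    positivity
  exact intervalIntegral.integral_hasDerivAt_right (hcont.intervalIntegrable _ _)
    (hcont.stronglyMeasurableAtFilter _ _) hcont.continuousAt

/-- The slope of `angleHeight` at the argument of `(t + i s) (1 - i)`. -/
lemma angleHeight_slope_arg {b s t : ℝ} (h : 0 < s ∨ 0 < t) :
    (√(b * (1 + b) + cos (2 * Complex.arg ⟨t + s, s - t⟩) ^ 2 / 4))⁻¹ =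
      (s ^ 2 + t ^ 2) / √(quarticForm b s t) := by
  have hr : 0 < s ^ 2 + t ^ 2 := by rcases h with h | h <;> positivity
  have hz : (⟨t + s, s - t⟩ : ℂ) ≠ 0 := by
    intro h0
    have h1 : t + s = 0 := congrArg Complex.re h0
    have h2 : s - t = 0 := congrArg Complex.im h0
    rcases h with h | h <;> linarith
  have hn : ‖(⟨t + s, s - t⟩ : ℂ)‖ ^ 2 = 2 * (s ^ 2 + t ^ 2) := by
    rw [← Complex.normSq_eq_norm_sq, Complex.normSq_mk]
    ring
  have : b * (1 + b) + cos (2 * Complex.arg ⟨t + s, s - t⟩) ^ 2 / 4 =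
      quarticForm b s t / (s ^ 2 + t ^ 2) ^ 2 := by
    rw [Real.cos_two_mul, Complex.cos_arg hz, div_pow, hn, quarticForm]
    field_simp
    ring
  rw [this, Real.sqrt_div' _ (by positivity), Real.sqrt_sq hr.le, inv_div]

/-- The height of the surface built from `s`: the one-parameter family deforming Scherk's surface
`log (cos v / cos u)`. -/
noncomputable def saddleHeight (b l : ℝ) (s : ℝ → ℝ) (p : ℝ × ℝ) : ℝ :=
  l⁻¹ * angleHeight b (Complex.arg ⟨s p.2 + s p.1, s p.1 - s p.2⟩)

/-- The slope of `saddleHeight` in the first variable; by antisymmetry the slope in the second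
variable is `-saddleSlope b s c p.swap`. -/
noncomputable def saddleSlope (b : ℝ) (s c : ℝ → ℝ) (p : ℝ × ℝ) : ℝ :=
  c p.1 * s p.2 / √(quarticForm b (s p.1) (s p.2))

lemma hasFDerivAt_saddleHeight {b l : ℝ} (hb : 0 < b) (hl : 0 < l) {s c : ℝ → ℝ}
    (hs : ∀ x, HasDerivAt s (l * c x) x) {p : ℝ × ℝ} (hp : 0 < s p.1 ∨ 0 < s p.2) :
    HasFDerivAt (saddleHeight b l s)
      (saddleSlope b s c p • ContinuousLinearMap.fst ℝ ℝ ℝ -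
        saddleSlope b s c p.swap • ContinuousLinearMap.snd ℝ ℝ ℝ) p := by
  have hr : 0 < s p.1 ^ 2 + s p.2 ^ 2 := by rcases hp with h | h <;> positivity
  have h1 : HasFDerivAt (fun p : ℝ × ℝ => s p.1) _ p :=
    (hs p.1).hasFDerivAt.comp p hasFDerivAt_fst
  have h2 : HasFDerivAt (fun p : ℝ × ℝ => s p.2) _ p :=
    (hs p.2).hasFDerivAt.comp p hasFDerivAt_snd
  have hz : HasFDerivAt (fun p : ℝ × ℝ => (⟨s p.2 + s p.1, s p.1 - s p.2⟩ : ℂ)) _ p :=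
    Complex.equivRealProdCLM.symm.hasFDerivAt.comp p ((h2.fun_add h1).prodMk (h1.fun_sub h2))
  have hslit : (⟨s p.2 + s p.1, s p.1 - s p.2⟩ : ℂ) ∈ Complex.slitPlane := by
    rw [Complex.mem_slitPlane_iff]
    by_cases h : s p.1 - s p.2 = 0
    · left
      change 0 < s p.2 + s p.1
      rcases hp with h' | h' <;> linarith
    · exact Or.inr h
  have harg : HasFDerivAt (fun p : ℝ × ℝ => Complex.arg ⟨s p.2 + s p.1, s p.1 - s p.2⟩) _ p :=
    (Complex.imCLM.hasFDerivAt.comp p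
      ((Complex.hasStrictFDerivAt_log_real hslit).hasFDerivAt.comp p hz)).congr_of_eventuallyEq
      (Filter.Eventually.of_forall fun q => (Complex.log_im _).symm)
  have hmain : HasFDerivAt (saddleHeight b l s) _ p :=
    ((hasDerivAt_angleHeight hb _).comp_hasFDerivAt p harg).const_mul l⁻¹
  refine hmain.congr_fderiv (ContinuousLinearMap.ext fun v => ?_)
  have hN : 0 < √(quarticForm b (s p.1) (s p.2)) := Real.sqrt_pos.2 (quarticForm_pos hb hp)
  rw [angleHeight_slope_arg hp]
  simp [saddleSlope, Complex.normSq_mk, quarticForm_comm b (s p.2)]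
  have hn : (s p.2 + s p.1) * (s p.2 + s p.1) + (s p.1 - s p.2) * (s p.1 - s p.2) =
    2 * (s p.1 ^ 2 + s p.2 ^ 2) := by ring
  rw [hn]
  field_simp
  ring

/-- Derivative of `saddleSlope` in its first variable. -/
noncomputable def saddleSlopeFst (b l : ℝ) (s c : ℝ → ℝ) (p : ℝ × ℝ) : ℝ :=
  l * ((-s p.1 - 2 * b * s p.1 ^ 3) * s p.2 / √(quarticForm b (s p.1) (s p.2)) -
    c p.1 ^ 2 * s p.2 * (2 * (b * (1 + b)) * s p.1 * (s p.1 ^ 2 + s p.2 ^ 2) + s p.1 * s p.2 ^ 2) /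
      √(quarticForm b (s p.1) (s p.2)) ^ 3)

/-- Derivative of `saddleSlope` in its second variable. -/
noncomputable def saddleSlopeSnd (b l : ℝ) (s c : ℝ → ℝ) (p : ℝ × ℝ) : ℝ :=
  l * (c p.1 * c p.2 / √(quarticForm b (s p.1) (s p.2)) -
    c p.1 * c p.2 * s p.2 *
      (2 * (b * (1 + b)) * s p.2 * (s p.1 ^ 2 + s p.2 ^ 2) + s p.2 * s p.1 ^ 2) /
      √(quarticForm b (s p.1) (s p.2)) ^ 3)

lemma hasFDerivAt_saddleSlope {b l : ℝ} (hb : 0 < b) {s c : ℝ → ℝ}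
    (hs : ∀ x, HasDerivAt s (l * c x) x)
    (hc : ∀ x, HasDerivAt c (l * (-s x - 2 * b * s x ^ 3)) x)
    {p : ℝ × ℝ} (hp : 0 < s p.1 ∨ 0 < s p.2) :
    HasFDerivAt (saddleSlope b s c)
      (saddleSlopeFst b l s c p • ContinuousLinearMap.fst ℝ ℝ ℝ +
        saddleSlopeSnd b l s c p • ContinuousLinearMap.snd ℝ ℝ ℝ) p := by
  have h1 : HasFDerivAt (fun p : ℝ × ℝ => s p.1) _ p :=
    (hs p.1).hasFDerivAt.comp p hasFDerivAt_fst
  have h2 : HasFDerivAt (fun p : ℝ × ℝ => s p.2) _ p :=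
    (hs p.2).hasFDerivAt.comp p hasFDerivAt_snd
  have h3 : HasFDerivAt (fun p : ℝ × ℝ => c p.1) _ p :=
    (hc p.1).hasFDerivAt.comp p hasFDerivAt_fst
  have hQ : HasFDerivAt (fun p : ℝ × ℝ => quarticForm b (s p.1) (s p.2)) _ p :=
    ((((h1.pow 2).fun_add (h2.pow 2)).pow 2).const_mul (b * (1 + b))).fun_add
      ((h1.pow 2).fun_mul (h2.pow 2))
  have hpos := quarticForm_pos hb hp
  have hN : 0 < √(quarticForm b (s p.1) (s p.2)) := Real.sqrt_pos.2 hpos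
  have hmain : HasFDerivAt (saddleSlope b s c) _ p :=
    (h3.fun_mul h2).fun_mul ((hasDerivAt_inv hN.ne').comp_hasFDerivAt p (hQ.sqrt hpos.ne'))
  refine hmain.congr_fderiv (ContinuousLinearMap.ext fun v => ?_)
  simp [saddleSlopeFst, saddleSlopeSnd]
  field_simp
  ring

lemma contDiffAt_saddleSlope {b : ℝ} (hb : 0 < b) {s c : ℝ → ℝ} (hs : ContDiff ℝ 1 s)
    (hc : ContDiff ℝ 1 c) {p : ℝ × ℝ} (hp : 0 < s p.1 ∨ 0 < s p.2) :
    ContDiffAt ℝ 1 (saddleSlope b s c) p := by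
  have hpos := quarticForm_pos hb hp
  have hQ : ContDiff ℝ 1 fun p : ℝ × ℝ => quarticForm b (s p.1) (s p.2) := by
    unfold quarticForm
    fun_prop
  exact (by fun_prop : ContDiff ℝ 1 fun p : ℝ × ℝ => c p.1 * s p.2).contDiffAt.div
    (hQ.contDiffAt.sqrt hpos.ne') (Real.sqrt_pos.2 hpos).ne'

/-- The minimal surface equation as an algebraic identity between the slopes. -/
lemma saddle_minimal_identity {b l : ℝ} (hb : 0 < b) {s c : ℝ → ℝ}
    (hsc : ∀ x, c x ^ 2 = 1 + b - s x ^ 2 - b * s x ^ 4) {p : ℝ × ℝ}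
    (hp : 0 < s p.1 ∨ 0 < s p.2) :
    (1 + (-saddleSlope b s c p.swap) ^ 2) * saddleSlopeFst b l s c p
      - 2 * saddleSlope b s c p * (-saddleSlope b s c p.swap) * saddleSlopeSnd b l s c p
      + (1 + saddleSlope b s c p ^ 2) * (-saddleSlopeFst b l s c p.swap) = 0 := by
  have hpos := quarticForm_pos hb hp
  have hN : 0 < √(quarticForm b (s p.1) (s p.2)) := Real.sqrt_pos.2 hpos
  have hN2 := Real.sq_sqrt hpos.le
  have e1 := hsc p.1
  have e2 := hsc p.2
  simp only [saddleSlope, saddleSlopeFst, saddleSlopeSnd, Prod.fst_swap, Prod.snd_swap,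
    quarticForm_comm b (s p.2) (s p.1)]
  generalize √(quarticForm b (s p.1) (s p.2)) = N at *
  rw [quarticForm] at hN2
  field_simp
  generalize s p.1 = x at *
  generalize s p.2 = y at *
  generalize c p.1 = u at *
  generalize c p.2 = v at *
  rw [hN2, e1, e2]
  ring

lemma sq_lt_half_or_sq_lt_half {x y : ℝ} (h : x ^ 2 + y ^ 2 < 1) :
    x ^ 2 < 1 / 2 ∨ y ^ 2 < 1 / 2 := by
  by_contra! hc
  linarith [hc.1, hc.2]

lemma isOpen_unitDisk : IsOpen unitDisk :=
  isOpen_lt (by fun_prop) continuous_const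

/-- If `f` is differentiable on an open set with partial derivatives `A` and `B`, and `A` and `B`
are `C¹`, then `f` is `C²`. -/
lemma contDiffOn_two_of_partials {D : Set (ℝ × ℝ)} (hD : IsOpen D) {f A B : ℝ × ℝ → ℝ}
    (hf : ∀ p ∈ D, HasFDerivAt f
      (A p • ContinuousLinearMap.fst ℝ ℝ ℝ - B p • ContinuousLinearMap.snd ℝ ℝ ℝ) p)
    (hA : ContDiffOn ℝ 1 A D) (hB : ContDiffOn ℝ 1 B D) : ContDiffOn ℝ 2 f D := by
  have h := (contDiffOn_succ_iff_fderiv_of_isOpen (𝕜 := ℝ) (n := 1) (f := f) hD).2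
    ⟨fun p hp => (hf p hp).differentiableAt.differentiableWithinAt, by simp,
      ((hA.smul contDiffOn_const).sub (hB.smul contDiffOn_const)).congr
        fun p hp => (hf p hp).fderiv⟩
  exact h.of_le (by norm_num [one_add_one_eq_two])

/-- **Sharpness of the π²/2 bound.**  For every `φ ∈ [0, π²/2)` there is a `C²` solution
of the minimal surface equation on the unit disk whose point above the origin is symmetric
and whose Gaussian curvature there has absolute value exactly `φ`. -/
theorem exists_minimal_graph_symmetric_with_curvature (φ : ℝ)
    (hφ0 : 0 ≤ φ) (hφ : φ < Real.pi ^ 2 / 2) :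
    ∃ f : ℝ × ℝ → ℝ, ContDiffOn ℝ 2 f unitDisk ∧ MinimalSurfaceEq f unitDisk ∧
      (∃ h : ℝ × ℝ, IsSymmetricPt f (0, 0) h) ∧ |gaussCurv f (0, 0)| = φ := by
  rcases hφ0.eq_or_lt with rfl | hφpos
  · have hu : pdu (fun _ => 0) = fun _ => 0 := by
      funext p
      simp [pdu, lineDeriv]
    have hv : pdv (fun _ => 0) = fun _ => 0 := by
      funext p
      simp [pdv, lineDeriv]
    exact ⟨fun _ => 0, contDiffOn_const, fun p _ => by simp [hu, hv],
      ⟨(1, 0), by norm_num, by simp [lineDeriv], by simp [lineDeriv]⟩, by simp [gaussCurv, hu, hv]⟩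
  obtain ⟨b, hb, hφb⟩ : ∃ b, 0 < b ∧ φ * (1 + 2 * b) = π ^ 2 / 2 :=
    ⟨(π ^ 2 / 2 - φ) / (2 * φ), div_pos (by linarith) (by linarith), by field_simp; ring⟩
  have hl : 0 < √φ := Real.sqrt_pos.2 hφpos
  have hl2 : √φ ^ 2 = φ := Real.sq_sqrt hφ0
  generalize √φ = l at hl hl2
  obtain ⟨s, c, hs, hc, hsc, hs0, hc0, hspos⟩ := exists_elliptic_sine hb hl
  have hdisk : ∀ p ∈ unitDisk, 0 < s p.1 ∨ 0 < s p.2 := by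
    have key : ∀ x : ℝ, x ^ 2 < 1 / 2 → 0 < s x := fun x hx => hspos x <| by
      rw [hl2, hφb]
      nlinarith [mul_lt_mul_of_pos_left hx (pow_pos Real.pi_pos 2)]
    exact fun p hp => (sq_lt_half_or_sq_lt_half hp).imp (key _) (key _)
  have hscont : ContDiff ℝ 1 s := contDiff_one_iff_deriv.2
    ⟨fun x => (hs x).differentiableAt, by
      rw [show deriv s = fun x => l * c x from funext fun x => (hs x).deriv]
      exact continuous_const.mul (continuous_iff_continuousAt.2 fun x => (hc x).continuousAt)⟩
  have hccont : ContDiff ℝ 1 c := contDiff_one_iff_deriv.2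
    ⟨fun x => (hc x).differentiableAt, by
      rw [show deriv c = _ from funext fun x => (hc x).deriv]
      have := hscont.continuous
      fun_prop⟩
  set f := saddleHeight b l s
  set A := saddleSlope b s c with hA
  have hfd : ∀ p ∈ unitDisk, HasFDerivAt f _ p := fun p hp =>
    hasFDerivAt_saddleHeight hb hl hs (hdisk p hp)
  have hAd : ∀ p ∈ unitDisk, HasFDerivAt A _ p := fun p hp =>
    hasFDerivAt_saddleSlope hb hs hc (hdisk p hp)
  have hswap : ∀ p ∈ unitDisk, p.swap ∈ unitDisk := fun p hp => by
    have : p.1 ^ 2 + p.2 ^ 2 < 1 := hp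
    change p.2 ^ 2 + p.1 ^ 2 < 1
    linarith
  have hBd : ∀ p ∈ unitDisk, HasFDerivAt (fun q : ℝ × ℝ => -A q.swap) _ p := fun p hp =>
    ((hAd _ (hswap p hp)).comp p
      (ContinuousLinearEquiv.prodComm ℝ ℝ ℝ).hasFDerivAt).fun_neg
  have hmem : ∀ p ∈ unitDisk, ∀ᶠ q in nhds p, q ∈ unitDisk := fun p hp =>
    isOpen_unitDisk.mem_nhds hp
  have hu : ∀ p ∈ unitDisk, pdu f p = A p := fun p hp => by
    simpa [pdu, hA] using ((hfd p hp).hasLineDerivAt (1, 0)).lineDeriv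
  have hv : ∀ p ∈ unitDisk, pdv f p = -A p.swap := fun p hp => by
    simpa [pdv, hA] using ((hfd p hp).hasLineDerivAt (0, 1)).lineDeriv
  have hue : ∀ p ∈ unitDisk, pdu f =ᶠ[nhds p] A := fun p hp => (hmem p hp).mono hu
  have hve : ∀ p ∈ unitDisk, pdv f =ᶠ[nhds p] fun q => -A q.swap := fun p hp =>
    (hmem p hp).mono hv
  have huu : ∀ p ∈ unitDisk, pdu (pdu f) p = saddleSlopeFst b l s c p := fun p hp => by
    rw [pdu, (hue p hp).lineDeriv_eq]
    simpa using ((hAd p hp).hasLineDerivAt (1, 0)).lineDeriv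
  have huv : ∀ p ∈ unitDisk, pdv (pdu f) p = saddleSlopeSnd b l s c p := fun p hp => by
    rw [pdv, (hue p hp).lineDeriv_eq]
    simpa using ((hAd p hp).hasLineDerivAt (0, 1)).lineDeriv
  have hvv : ∀ p ∈ unitDisk, pdv (pdv f) p = -saddleSlopeFst b l s c p.swap := fun p hp => by
    rw [pdv, (hve p hp).lineDeriv_eq]
    simpa using ((hBd p hp).hasLineDerivAt (0, 1)).lineDeriv
  have h0 : ((0, 0) : ℝ × ℝ) ∈ unitDisk := by norm_num [unitDisk]
  have hA0 : A (0, 0) = 0 := by simp [hA, saddleSlope, hc0]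
  have hsnd0 : saddleSlopeSnd b l s c (0, 0) = 0 := by simp [saddleSlopeSnd, hc0]
  have hfst0 : saddleSlopeFst b l s c (0, 0) = -l := by
    have hN : √(quarticForm b 1 1) = 1 + 2 * b := by
      rw [show quarticForm b 1 1 = (1 + 2 * b) ^ 2 by unfold quarticForm; ring,
        Real.sqrt_sq (by positivity)]
    simp only [saddleSlopeFst, hc0, hs0, hN]
    field_simp
    ring
  refine ⟨f, ?_, fun p hp => ?_, ⟨(1, 0), by norm_num, (hu _ h0).trans hA0, ?_⟩, ?_⟩
  · have hA1 : ContDiffOn ℝ 1 A unitDisk := fun p hp =>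
      (contDiffAt_saddleSlope hb hscont hccont (hdisk p hp)).contDiffWithinAt
    exact contDiffOn_two_of_partials isOpen_unitDisk hfd hA1
      (hA1.comp (ContinuousLinearEquiv.prodComm ℝ ℝ ℝ).contDiff.contDiffOn hswap)
  · rw [hu p hp, hv p hp, huu p hp, huv p hp, hvv p hp]
    exact saddle_minimal_identity hb hsc (hdisk p hp)
  · simpa [hsnd0, pdv] using! huv _ h0
  · rw [gaussCurv, huu _ h0, huv _ h0, hvv _ h0, hu _ h0, hv _ h0, Prod.swap_prod_mk, hA0, hsnd0,
      hfst0, ← hl2]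
    norm_num
    rw [← sq]
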